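/- Assume Setting 3. Then for all t = 1,…,T−1, N ∈ ℕ and every cube G in the (uniform or non-uniform) partition Φ^N_t of ℝ^{dt}, there exist f_G ∈ ℝ^d and σ_G, λ_G > 0 with σ_G = max{sup_{x_{1:t}∈G} σ_t(x_{1:t}), 1} and λ_G = 2(L_f·diam(G) + 1) + 2γ^{−α}, such that ∫ exp(‖y‖^α) d((1/λ_G)·((μ_G − f_G)/σ_G))(y) ≤ e · sup_{x_{1:t}∈ℝ^{dt}} E_{α,γ}(λ_{x_{1:t}}), where for a probability measure γ' on ℝ^d, γ' + f denotes the pushforward of γ' under x ↦ x + f and σγ' the pushforward under x ↦ σx. -/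

import Mathlib

open MeasureTheory ProbabilityTheory Filter Set
open scoped ENNReal NNReal Topology Classical

noncomputable section

namespace AWPaper

/-- The state space `ℝ^d` with Euclidean norm. -/
abbrev E (d : ℕ) := EuclideanSpace ℝ (Fin d)

/-- Paths of length `t` with values in `ℝ^d`. -/
abbrev PathT (d t : ℕ) := Fin t → E d

/-- Sum-norm `‖x‖ = ∑_t ‖x_t‖` of a (partial) path. -/
def sumNorm {d t : ℕ} (a : PathT d t) : ℝ := ∑ s, ‖a s‖

/-- Sum-distance `∑_t ‖x_t - y_t‖` of two (partial) paths. -/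
def sumDist {d t : ℕ} (a b : PathT d t) : ℝ := ∑ s, ‖a s - b s‖

/-- Couplings of two measures. -/
def Cpl {α β : Type*} [MeasurableSpace α] [MeasurableSpace β]
    (μ : Measure α) (ν : Measure β) : Set (Measure (α × β)) :=
  {π | π.map Prod.fst = μ ∧ π.map Prod.snd = ν}

/-- First order Wasserstein distance (with value in `ℝ≥0∞`). -/
def W1 {α : Type*} [MeasurableSpace α] [PseudoEMetricSpace α]
    (μ ν : Measure α) : ℝ≥0∞ :=
  ⨅ π ∈ Cpl μ ν, ∫⁻ p, edist p.1 p.2 ∂π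

/-- Restriction of a path to its first `t` coordinates. -/
def restr (d T : ℕ) {t : ℕ} (h : t ≤ T) : PathT d T → PathT d t :=
  fun x i => x (Fin.castLE h i)

/-- The pair (first `t` coordinates, coordinate `t`); used for disintegration. -/
def frontMap (d T : ℕ) {t : ℕ} (ht : t < T) : PathT d T → PathT d t × E d :=
  fun x => (restr d T ht.le x, x ⟨t, ht⟩)

/-- Totalized version of `Measure.condKernel` (zero measure if the joint measure is not
finite). -/
def condKerTotal {α Ω : Type*} [MeasurableSpace α] [MeasurableSpace Ω]
    [StandardBorelSpace Ω] [Nonempty Ω] (ρ : Measure (α × Ω)) : α → Measure Ω :=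
  if h : IsFiniteMeasure ρ then fun a => (@Measure.condKernel α Ω _ _ _ _ ρ h) a
  else fun _ => 0

/-- The (canonical) kernel `μ_{x_{1:t}}` of `μ`: the disintegration of the law of the
`(t+1)`-st coordinate given the first `t` coordinates. -/
def muKer {d T : ℕ} (μ : Measure (PathT d T)) {t : ℕ} (ht : t < T) :
    PathT d t → Measure (E d) :=
  condKerTotal (μ.map (frontMap d T ht))

/-- Joint restriction map for couplings. -/
def pairFront (d T : ℕ) {t : ℕ} (ht : t < T) :
    PathT d T × PathT d T → (PathT d t × PathT d t) × (E d × E d) :=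
  fun p => ((restr d T ht.le p.1, restr d T ht.le p.2), (p.1 ⟨t, ht⟩, p.2 ⟨t, ht⟩))

/-- A coupling `π` of `μ` and `ν` is bi-causal if for each `t = 1,…,T-1` the disintegration
of `π` given the first `t` coordinates of both paths is (a.e.) a coupling of the
corresponding kernels of `μ` and `ν`. -/
def Bicausal {d T : ℕ} (μ ν : Measure (PathT d T))
    (π : Measure (PathT d T × PathT d T)) : Prop :=
  π ∈ Cpl μ ν ∧
  ∀ (t : ℕ) (ht : t < T), 1 ≤ t →
    ∀ᵐ ab ∂(π.map (fun p => (restr d T ht.le p.1, restr d T ht.le p.2))),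
      condKerTotal (π.map (pairFront d T ht)) ab ∈ Cpl (muKer μ ht ab.1) (muKer ν ht ab.2)

/-- The (first order) adapted Wasserstein distance. -/
def AW {d T : ℕ} (μ ν : Measure (PathT d T)) : ℝ≥0∞ :=
  ⨅ π ∈ {π | Bicausal μ ν π}, ∫⁻ p, (∑ t, edist (p.1 t) (p.2 t)) ∂π

/-- Empirical measure of the first `N` elements of a sequence of samples. -/
def emp {α : Type*} [MeasurableSpace α] (x : ℕ → α) (N : ℕ) : Measure α :=
  (N : ℝ≥0∞)⁻¹ • ∑ n ∈ Finset.range N, Measure.dirac (x n)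

/-- Empirical measure of a finite family of samples. -/
def empFin {α : Type*} [MeasurableSpace α] {k : ℕ} (y : Fin k → α) : Measure α :=
  (k : ℝ≥0∞)⁻¹ • ∑ i, Measure.dirac (y i)

/-- The grid size `Δ_N = N^{-1/(dT)}`. -/
def ΔN (d T N : ℕ) : ℝ := (N : ℝ) ^ (-(1 : ℝ) / (d * T))

/-- `m = ⌈1/Δ_N⌉`. -/
def mOf (d T N : ℕ) : ℕ := ⌈(1 : ℝ) / ΔN d T N⌉₊

/-- Midpoint of the grid cube of side length `s` containing `u`. -/
def gridPt (s u : ℝ) : ℝ := (⌊u / s⌋ + 2⁻¹) * s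

/-- Projection of a path onto the midpoints of the uniform grid of side `1/m`,
`m = ⌈N^{1/(dT)}⌉`. -/
def unifProj (d T N : ℕ) : PathT d T → PathT d T :=
  fun x t => (WithLp.equiv 2 (Fin d → ℝ)).symm
    (fun i => gridPt ((mOf d T N : ℝ))⁻¹ (x t i))

/-- The sup-norm over all real coordinates of a (partial) path. -/
def supA {d t : ℕ} (a : PathT d t) : ℝ≥0 :=
  Finset.univ.sup (fun p : Fin t × Fin d => ‖a p.1 p.2‖₊)

lemma ringIdx_ex {d t : ℕ} (a : PathT d t) : ∃ j : ℕ, supA a ≤ 2 ^ j :=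
  (pow_unbounded_of_one_lt (supA a) one_lt_two).imp fun _ h => h.le

/-- The index of the cubic ring `A_j` containing a given point: the least `j` with
`‖a‖_∞ ≤ 2^j`. -/
def ringIdx {d t : ℕ} (a : PathT d t) : ℕ := Nat.find (ringIdx_ex a)

/-- The cubic ring `A^t_j` (points whose ring index is `j`). -/
def ringSet (d t : ℕ) (j : ℕ) : Set (PathT d t) := {a | ringIdx a = j}

/-- Side length `2^{j-1}/m` of the cubes of the non-uniform grid inside the ring `A_j`. -/
def sideLen (m j : ℕ) : ℝ := (2 : ℝ) ^ ((j : ℤ) - 1) / m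

/-- Projection of a path onto the midpoints of the non-uniform grid. -/
def nonUnifProj (d T N : ℕ) : PathT d T → PathT d T :=
  fun x t => (WithLp.equiv 2 (Fin d → ℝ)).symm
    (fun i => gridPt (sideLen (mOf d T N) (ringIdx x)) (x t i))

/-- Index set for the cubes of the uniform grid on `ℝ^{dt}`. -/
abbrev Idx (d t : ℕ) := Fin t → Fin d → ℤ

/-- Cube of the uniform grid of side `1/m` on `ℝ^{dt}`. -/
def unifCell (d t m : ℕ) (z : Idx d t) : Set (PathT d t) :=
  {a | ∀ s i, ⌊a s i * m⌋ = z s i}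

/-- Cube of the non-uniform grid, inside the ring `A^t_j`. -/
def nonUnifCell (d t m : ℕ) (j : ℕ) (z : Idx d t) : Set (PathT d t) :=
  {a | ringIdx a = j ∧ ∀ s i, ⌊a s i / sideLen m j⌋ = z s i}

/-- The cubes of the uniform grid. -/
def unifCells (d t m : ℕ) : Set (Set (PathT d t)) := Set.range (unifCell d t m)

/-- The cubes of the non-uniform grid. -/
def nonUnifCells (d t m : ℕ) : Set (Set (PathT d t)) :=
  Set.range (fun p : ℕ × Idx d t => nonUnifCell d t m p.1 p.2)

/-- Mass given by (the up-to-time-`t` marginal of) `ρ` to a set `G ⊆ ℝ^{dt}`. -/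
def cellMass {d T : ℕ} (ρ : Measure (PathT d T)) {t : ℕ} (h : t ≤ T)
    (G : Set (PathT d t)) : ℝ≥0∞ :=
  ρ (restr d T h ⁻¹' G)

/-- The average kernel `μ_G` of `μ` on `G`:
`μ_G(B) = μ(X_{1:t} ∈ G, X_{t+1} ∈ B)/μ(X_{1:t} ∈ G)`, and `δ_0` if `μ(X_{1:t} ∈ G) = 0`. -/
def avgKer {d T : ℕ} (μ : Measure (PathT d T)) {t : ℕ} (ht : t < T)
    (G : Set (PathT d t)) : Measure (E d) :=
  if μ (restr d T ht.le ⁻¹' G) = 0 then Measure.dirac 0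
  else (μ (restr d T ht.le ⁻¹' G))⁻¹ •
    ((μ.restrict (restr d T ht.le ⁻¹' G)).map (fun x => x ⟨t, ht⟩))

/-- `‖G‖ = sup_{x ∈ G} ‖x‖` (sum-norm), with value in `ℝ≥0∞`. -/
def cellNorm {d t : ℕ} (G : Set (PathT d t)) : ℝ≥0∞ :=
  ⨆ a ∈ G, ∑ s, (‖a s‖₊ : ℝ≥0∞)

/-- `diam(G) = sup_{x,y ∈ G} ‖x - y‖` (sum-norm), with value in `ℝ≥0∞`. -/
def cellDiam {d t : ℕ} (G : Set (PathT d t)) : ℝ≥0∞ :=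
  ⨆ a ∈ G, ⨆ b ∈ G, ∑ s, edist (a s) (b s)

/-- `p`-th moment `M_p(ρ) = ∫ ‖y‖^p dρ` of a measure on `ℝ^d`. -/
def Mp {d : ℕ} (p : ℝ) (ρ : Measure (E d)) : ℝ≥0∞ :=
  ∫⁻ y, (‖y‖₊ : ℝ≥0∞) ^ p ∂ρ

/-- `(α,γ)`-exponential moment `E_{α,γ}(ρ) = ∫ exp(γ‖y‖^α) dρ` of a measure on `ℝ^d`. -/
def ExpM {d : ℕ} (α γ : ℝ) (ρ : Measure (E d)) : ℝ≥0∞ :=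
  ∫⁻ y, ENNReal.ofReal (Real.exp (γ * ‖y‖ ^ α)) ∂ρ

/-- `q`-th moment of a measure on path space (with the sum-norm). -/
def pathMom {d T : ℕ} (q : ℝ) (μ : Measure (PathT d T)) : ℝ≥0∞ :=
  ∫⁻ x, (ENNReal.ofReal (sumNorm x)) ^ q ∂μ

/-- `K` is a disintegration (kernel family) of the `(t+1)`-st coordinate of `μ` given the
first `t` coordinates. -/
def IsDisint {d T : ℕ} (μ : Measure (PathT d T)) {t : ℕ} (ht : t < T)
    (K : PathT d t → Measure (E d)) : Prop :=
  (∀ a, IsProbabilityMeasure (K a)) ∧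
  (∀ B : Set (E d), MeasurableSet B → Measurable fun a => K a B) ∧
  ∀ (A : Set (PathT d t)) (B : Set (E d)), MeasurableSet A → MeasurableSet B →
    μ ((restr d T ht.le ⁻¹' A) ∩ ((fun x => x ⟨t, ht⟩) ⁻¹' B))
      = ∫⁻ a in A, K a B ∂(μ.map (restr d T ht.le))

/-- `μ` has `L`-Lipschitz kernels: some disintegration is `L`-Lipschitz w.r.t. the
Wasserstein distance. -/
def HasLipKernels (d T : ℕ) (L : ℝ) (μ : Measure (PathT d T)) : Prop :=
  ∃ K : (t : ℕ) → t < T → PathT d t → Measure (E d),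
    ∀ (t : ℕ) (ht : t < T), 1 ≤ t → IsDisint μ ht (K t ht) ∧
      ∀ a b, W1 (K t ht a) (K t ht b) ≤ ENNReal.ofReal (L * sumDist a b)

/-- The noise-kernel decomposition data of a measure `μ` on path space:
kernels `K`, functions `f_t`, `σ_t` and noise laws `λ_{x_{1:t}}` with
`μ_{x_{1:t}} = law of f_t(x_{1:t}) + σ_t(x_{1:t})·ε`, `ε ∼ λ_{x_{1:t}}`. -/
structure KernelData (d T : ℕ) (μ : Measure (PathT d T)) where
  K : (t : ℕ) → t < T → PathT d t → Measure (E d)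
  f : (t : ℕ) → t < T → PathT d t → E d
  sig : (t : ℕ) → t < T → PathT d t → ℝ
  lam : (t : ℕ) → t < T → PathT d t → Measure (E d)
  disint : ∀ (t : ℕ) (ht : t < T), 1 ≤ t → IsDisint μ ht (K t ht)
  lamProb : ∀ (t : ℕ) (ht : t < T) (a : PathT d t), IsProbabilityMeasure (lam t ht a)
  sigNonneg : ∀ (t : ℕ) (ht : t < T) (a : PathT d t), 0 ≤ sig t ht a
  decomp : ∀ (t : ℕ) (ht : t < T) (a : PathT d t), 1 ≤ t →
    K t ht a = (lam t ht a).map (fun e => f t ht a + sig t ht a • e)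

/-- The kernels are `L`-Lipschitz w.r.t. the Wasserstein distance. -/
def KernelData.Lip {d T : ℕ} {μ : Measure (PathT d T)} (κ : KernelData d T μ)
    (L : ℝ) : Prop :=
  ∀ (t : ℕ) (ht : t < T), 1 ≤ t → ∀ a b,
    W1 (κ.K t ht a) (κ.K t ht b) ≤ ENNReal.ofReal (L * sumDist a b)

/-- Growth condition `σ_t(x_{1:t}) ≤ c ‖x_{1:t}‖^r`. -/
def KernelData.Growth {d T : ℕ} {μ : Measure (PathT d T)} (κ : KernelData d T μ)
    (c r : ℝ) : Prop :=
  ∀ (t : ℕ) (ht : t < T) (a : PathT d t), 1 ≤ t → κ.sig t ht a ≤ c * sumNorm a ^ r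

/-- The functions `f_t` are `L_f`-Lipschitz. -/
def KernelData.fLip {d T : ℕ} {μ : Measure (PathT d T)} (κ : KernelData d T μ)
    (Lf : ℝ) : Prop :=
  ∀ (t : ℕ) (ht : t < T), 1 ≤ t → ∀ a b,
    ‖κ.f t ht a - κ.f t ht b‖ ≤ Lf * sumDist a b

/-- `D(d) = d+1` for `d ∈ {1,2}` and `D(d) = d` for `d ≥ 3`. -/
def Dd (d : ℕ) : ℝ := if d ≤ 2 then (d : ℝ) + 1 else (d : ℝ)

/-- Common part of Settings 1 and 2. -/
structure SettingBase (d T : ℕ) (r p L Lf : ℝ) (μ : Measure (PathT d T))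
    (κ : KernelData d T μ) : Prop where
  hd : 0 < d
  hT : 2 ≤ T
  hr : 0 ≤ r
  hp : 1 ≤ p
  hLf : 0 < Lf
  hprob : IsProbabilityMeasure μ
  hLip : κ.Lip L
  hgrow : ∃ c : ℝ, 0 < c ∧ κ.Growth c r
  hfLip : κ.fLip Lf
  hmom : ∃ M : ℝ≥0∞, M ≠ ⊤ ∧ ∀ (t : ℕ) (ht : t < T), 1 ≤ t → ∀ a, Mp p (κ.lam t ht a) ≤ M

/-- Setting 1. -/
def Setting1 (d T : ℕ) (r p q L Lf : ℝ) (μ : Measure (PathT d T))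
    (κ : KernelData d T μ) : Prop :=
  SettingBase d T r p L Lf μ κ ∧
  max ((Dd d / (Dd d - 1)) * (r + T - 1)) (r * p + Dd d * (T - 1) * (p - 1)) < q ∧
  pathMom q μ < ⊤

/-- Setting 2. -/
def Setting2 (d T : ℕ) (r p q L Lf : ℝ) (μ : Measure (PathT d T))
    (κ : KernelData d T μ) : Prop :=
  SettingBase d T r p L Lf μ κ ∧
  max (r * Dd d / (Dd d - 1)) ((r + 1) * p) < q ∧
  pathMom q μ < ⊤

/-- Setting 3. -/
structure Setting3 (d T : ℕ) (r α γ L Lf : ℝ) (μ : Measure (PathT d T))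
    (κ : KernelData d T μ) : Prop where
  hd : 0 < d
  hT : 2 ≤ T
  hr : 0 ≤ r
  hα : 2 ≤ α
  hγ : 0 < γ
  hLf : 0 < Lf
  hprob : IsProbabilityMeasure μ
  hexpmom : ∫⁻ x, ENNReal.ofReal (Real.exp (γ * sumNorm x ^ α)) ∂μ < ⊤
  hLip : κ.Lip L
  hgrow : ∃ c : ℝ, 0 < c ∧ κ.Growth c r
  hfLip : κ.fLip Lf
  hulam : ∃ M : ℝ≥0∞, M ≠ ⊤ ∧ ∀ (t : ℕ) (ht : t < T), 1 ≤ t → ∀ a,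
    ExpM α γ (κ.lam t ht a) ≤ M

end AWPaper

namespace AWPaper

section Cells

variable {d t : ℕ}

lemma mOf_pos (d T : ℕ) {N : ℕ} (hN : 1 ≤ N) : 0 < mOf d T N := by
  have hN' : (0 : ℝ) < N := by exact_mod_cast hN
  exact Nat.ceil_pos.mpr (one_div_pos.mpr (Real.rpow_pos_of_pos hN' _))

lemma norm_le_sum_abs (v : E d) : ‖v‖ ≤ ∑ i, |v i| := by
  rw [EuclideanSpace.norm_eq]
  refine Real.sqrt_le_iff.mpr ⟨Finset.sum_nonneg fun i _ => abs_nonneg _, ?_⟩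
  exact Finset.sum_sq_le_sq_sum_of_nonneg fun i _ => abs_nonneg (v i)

lemma abs_le_of_floor_div_eq {x h : ℝ} {z : ℤ} (hh : 0 < h) (hz : ⌊x / h⌋ = z) :
    |x| ≤ (|(z : ℝ)| + 1) * h := by
  obtain ⟨h1, h2⟩ := Int.floor_eq_iff.mp hz
  have h3 : |x / h| ≤ |(z : ℝ)| + 1 :=
    abs_le.mpr ⟨by linarith [neg_abs_le (z : ℝ)], by linarith [le_abs_self (z : ℝ)]⟩
  rwa [abs_div, abs_of_pos hh, div_le_iff₀ hh] at h3

lemma sumNorm_le_of_floor_div_eq {h : ℝ} (hh : 0 < h) {z : Idx d t} {a : PathT d t}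
    (ha : ∀ s i, ⌊a s i / h⌋ = z s i) :
    sumNorm a ≤ ∑ s, ∑ i, (|(z s i : ℝ)| + 1) * h :=
  Finset.sum_le_sum fun s _ => (norm_le_sum_abs _).trans <|
    Finset.sum_le_sum fun i _ => abs_le_of_floor_div_eq hh (ha s i)

lemma exists_sumNorm_le_of_mem_cells {m : ℕ} (hm : 0 < m) {G : Set (PathT d t)}
    (hG : G ∈ unifCells d t m ∪ nonUnifCells d t m) : ∃ R, ∀ a ∈ G, sumNorm a ≤ R := by
  have hm' : (0 : ℝ) < m := by exact_mod_cast hm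
  rcases hG with ⟨z, rfl⟩ | ⟨⟨j, z⟩, rfl⟩
  · refine ⟨_, fun a ha => sumNorm_le_of_floor_div_eq (z := z) (inv_pos.mpr hm') fun s i => ?_⟩
    rw [div_inv_eq_mul]
    exact ha s i
  · exact ⟨_, fun a ha => sumNorm_le_of_floor_div_eq (z := z)
      (div_pos (zpow_pos two_pos _) hm') ha.2⟩

lemma measurable_coord (s : Fin t) (i : Fin d) : Measurable fun a : PathT d t => a s i :=
  (EuclideanSpace.proj (𝕜 := ℝ) i).continuous.measurable.comp (measurable_pi_apply s)

lemma measurable_ringIdx : Measurable (ringIdx : PathT d t → ℕ) := by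
  refine measurable_find _ fun j => ?_
  simp only [supA, Finset.sup_le_iff, Finset.mem_univ, forall_true_left, ofPred_forall]
  exact MeasurableSet.iInter fun p =>
    measurableSet_le (measurable_coord p.1 p.2).nnnorm measurable_const

lemma measurableSet_floor_coord_eq {φ : ℝ → ℝ} (hφ : Measurable φ) (z : Idx d t) :
    MeasurableSet {a : PathT d t | ∀ s i, ⌊φ (a s i)⌋ = z s i} := by
  simp only [ofPred_forall]
  exact MeasurableSet.iInter fun s => MeasurableSet.iInter fun i =>
    (Int.measurable_floor.comp (hφ.comp (measurable_coord s i))) (measurableSet_singleton (z s i))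

lemma measurableSet_of_mem_cells {m : ℕ} {G : Set (PathT d t)}
    (hG : G ∈ unifCells d t m ∪ nonUnifCells d t m) : MeasurableSet G := by
  rcases hG with ⟨z, rfl⟩ | ⟨⟨j, z⟩, rfl⟩
  · exact measurableSet_floor_coord_eq (measurable_id.mul_const (m : ℝ)) z
  · exact (measurable_ringIdx (measurableSet_singleton j)).inter
      (measurableSet_floor_coord_eq (measurable_id.div_const (sideLen m j)) z)

lemma sum_edist_eq_ofReal_sumDist (a b : PathT d t) :
    ∑ s, edist (a s) (b s) = ENNReal.ofReal (sumDist a b) := by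
  rw [sumDist, ENNReal.ofReal_sum_of_nonneg fun s _ => norm_nonneg _]
  exact Finset.sum_congr rfl fun s _ => by rw [edist_dist, dist_eq_norm]

lemma cellDiam_ne_top {G : Set (PathT d t)} {R : ℝ} (hR : ∀ a ∈ G, sumNorm a ≤ R) :
    cellDiam G ≠ ⊤ := by
  refine ne_top_of_le_ne_top (ENNReal.ofReal_ne_top (r := R + R))
    (iSup₂_le fun a ha => iSup₂_le fun b hb => ?_)
  rw [sum_edist_eq_ofReal_sumDist]
  refine ENNReal.ofReal_le_ofReal (le_trans ?_ (add_le_add (hR a ha) (hR b hb)))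
  rw [sumNorm, sumNorm, ← Finset.sum_add_distrib]
  exact Finset.sum_le_sum fun s _ => norm_sub_le _ _

lemma sumDist_le_toReal_cellDiam {G : Set (PathT d t)} (hG : cellDiam G ≠ ⊤) {a b : PathT d t}
    (ha : a ∈ G) (hb : b ∈ G) : sumDist a b ≤ (cellDiam G).toReal := by
  rw [← ENNReal.ofReal_le_iff_le_toReal hG, ← sum_edist_eq_ofReal_sumDist]
  exact le_iSup₂_of_le a ha (le_iSup₂_of_le b hb le_rfl)

end Cells

section Kernels

variable {d T t : ℕ} {μ : Measure (PathT d T)}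

lemma measurable_restr (h : t ≤ T) : Measurable (restr d T h) :=
  measurable_pi_lambda _ fun _ => measurable_pi_apply _

lemma IsDisint.map_restrict_eq_bind {ht : t < T} {K : PathT d t → Measure (E d)}
    (hK : IsDisint μ ht K) {G : Set (PathT d t)} (hG : MeasurableSet G) :
    (μ.restrict (restr d T ht.le ⁻¹' G)).map (fun x => x ⟨t, ht⟩) =
      ((μ.map (restr d T ht.le)).restrict G).bind K := by
  have hx : Measurable fun x : PathT d T => x ⟨t, ht⟩ := measurable_pi_apply _
  ext B hB
  rw [Measure.map_apply hx hB, Measure.restrict_apply (hx hB), inter_comm, hK.2.2 G B hG hB,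
    Measure.bind_apply hB (Measure.measurable_of_measurable_coe K hK.2.1).aemeasurable]

lemma IsDisint.lintegral_avgKer_le [IsProbabilityMeasure μ] {ht : t < T}
    {K : PathT d t → Measure (E d)} (hK : IsDisint μ ht K) {G : Set (PathT d t)}
    (hG : MeasurableSet G) (hμ : μ (restr d T ht.le ⁻¹' G) ≠ 0) {g : E d → ℝ≥0∞}
    (hg : Measurable g) {C : ℝ≥0∞} (hC : ∀ a ∈ G, ∫⁻ y, g y ∂K a ≤ C) :
    ∫⁻ y, g y ∂avgKer μ ht G ≤ C := by
  rw [avgKer, if_neg hμ, lintegral_smul_measure, hK.map_restrict_eq_bind hG,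
    Measure.lintegral_bind (Measure.measurable_of_measurable_coe K hK.2.1).aemeasurable
      hg.aemeasurable, smul_eq_mul]
  calc _ ≤ (μ (restr d T ht.le ⁻¹' G))⁻¹ * ∫⁻ _ in G, C ∂(μ.map (restr d T ht.le)) :=
        mul_le_mul_right (setLIntegral_mono' hG hC) _
    _ = C := by
        rw [setLIntegral_const, Measure.map_apply (measurable_restr ht.le) hG, mul_left_comm,
          ENNReal.inv_mul_cancel hμ (measure_ne_top _ _), mul_one]

lemma one_le_ExpM {α γ : ℝ} (hγ : 0 ≤ γ) (ρ : Measure (E d)) [IsProbabilityMeasure ρ] :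
    1 ≤ ExpM α γ ρ := by
  calc (1 : ℝ≥0∞) = ∫⁻ _, 1 ∂ρ := by simp
    _ ≤ ExpM α γ ρ := lintegral_mono fun y => ENNReal.one_le_ofReal.mpr
        (Real.one_le_exp (by positivity))

end Kernels

/-- A version of `(u + v)^α ≤ 2^(α-1) (u^α + v^α)` adapted to the scaling
`ℓ = 2 (D + 1) + 2 γ^(-α)`. -/
lemma add_div_rpow_le {α γ D n : ℝ} (hα : 1 ≤ α) (hγ : 0 < γ) (hD : 0 ≤ D) (hn : 0 ≤ n) :
    ((D + n) / (2 * (D + 1) + 2 * γ ^ (-α))) ^ α ≤ 1 + γ * n ^ α := by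
  have hp : 0 < γ ^ (-α) := Real.rpow_pos_of_pos hγ _
  set l := 2 * (D + 1) + 2 * γ ^ (-α) with hl
  have hl0 : 0 < l := by positivity
  have hα0 : 0 < α := by linarith
  have hu : (2 * D / l) ^ α ≤ 1 := by
    refine Real.rpow_le_one (by positivity) ?_ hα0.le
    rw [div_le_one hl0]
    linarith
  have hroot : γ ^ (-α⁻¹) ≤ l / 2 := by
    rcases le_total γ 1 with h | h
    · have : γ ^ (-α⁻¹) ≤ γ ^ (-α) :=
        Real.rpow_le_rpow_of_exponent_ge hγ h (neg_le_neg ((inv_le_one_of_one_le₀ hα).trans hα))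
      linarith
    · have : γ ^ (-α⁻¹) ≤ 1 :=
        Real.rpow_le_one_of_one_le_of_nonpos h (neg_nonpos.mpr (inv_nonneg.mpr hα0.le))
      linarith
  have hv : (2 * n / l) ^ α ≤ γ * n ^ α := by
    have h1 : 2 * n / l ≤ γ ^ α⁻¹ * n := by
      rw [div_le_iff₀ hl0]
      have h2 : 1 ≤ γ ^ α⁻¹ * (l / 2) := by
        calc (1 : ℝ) = γ ^ α⁻¹ * γ ^ (-α⁻¹) := by
              rw [← Real.rpow_add hγ, add_neg_cancel, Real.rpow_zero]
          _ ≤ _ := by gcongr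
      nlinarith
    calc (2 * n / l) ^ α ≤ (γ ^ α⁻¹ * n) ^ α := by gcongr
      _ = γ * n ^ α := by
        rw [Real.mul_rpow (by positivity) hn, ← Real.rpow_mul hγ.le, inv_mul_cancel₀ hα0.ne',
          Real.rpow_one]
  have hconv := (convexOn_rpow hα).2 (x := 2 * D / l) (y := 2 * n / l)
    (mem_Ici.mpr (by positivity)) (mem_Ici.mpr (by positivity))
    (show (0 : ℝ) ≤ 1 / 2 by norm_num) (show (0 : ℝ) ≤ 1 / 2 by norm_num) (by norm_num)
  have hmid : (1 / 2 : ℝ) • (2 * D / l) + (1 / 2 : ℝ) • (2 * n / l) = (D + n) / l := by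
    simp only [smul_eq_mul]
    ring
  rw [hmid] at hconv
  simp only [smul_eq_mul] at hconv
  have : 0 ≤ γ * n ^ α := by positivity
  linarith

/-- The exponential moment of an affine image `v + s • ε` of a noise, recentred at a point within
distance `D` of `v` and rescaled. -/
lemma lintegral_exp_affine_le {d : ℕ} {α γ D s S : ℝ} (hα : 1 ≤ α) (hγ : 0 < γ) (hD : 0 ≤ D)
    (hs : 0 ≤ s) (hsS : s ≤ S) (hS : 1 ≤ S) {v w : E d} (hvw : ‖v - w‖ ≤ D)
    (ρ : Measure (E d)) :
    ∫⁻ e, ENNReal.ofReal (Real.exp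
        (‖(S * (2 * (D + 1) + 2 * γ ^ (-α)))⁻¹ • (v + s • e - w)‖ ^ α)) ∂ρ ≤
      ENNReal.ofReal (Real.exp 1) * ExpM α γ ρ := by
  have hp : 0 < γ ^ (-α) := Real.rpow_pos_of_pos hγ _
  have hS0 : 0 < S := by linarith
  rw [ExpM, ← lintegral_const_mul' _ _ ENNReal.ofReal_ne_top]
  refine lintegral_mono fun e => ?_
  dsimp only
  rw [← ENNReal.ofReal_mul (Real.exp_pos _).le, ← Real.exp_add]
  refine ENNReal.ofReal_le_ofReal (Real.exp_le_exp.mpr ?_)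
  refine le_trans (Real.rpow_le_rpow (norm_nonneg _) ?_ (by linarith))
    (add_div_rpow_le hα hγ hD (norm_nonneg e))
  have h1 : ‖v + s • e - w‖ ≤ S * (D + ‖e‖) := by
    calc ‖v + s • e - w‖ = ‖(v - w) + s • e‖ := by congr 1; abel
      _ ≤ ‖v - w‖ + ‖s • e‖ := norm_add_le _ _
      _ ≤ D + S * ‖e‖ := by
        rw [norm_smul, Real.norm_of_nonneg hs]
        gcongr
      _ ≤ S * (D + ‖e‖) := by nlinarith
  rw [norm_smul, norm_inv, Real.norm_of_nonneg (by positivity), inv_mul_le_iff₀ (by positivity)]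
  refine h1.trans (le_of_eq ?_)
  field_simp

end AWPaper

open AWPaper in
/-- Lemma 3.3(ii): under Setting 3, for every cube `G` of the (uniform or
non-uniform) grid there exists `f_G ∈ ℝ^d` such that, with `σ_G = max{sup_{x∈G} σ_t(x), 1}`
and `λ_G = 2(L_f diam(G) + 1) + 2γ^{-α}`, one has
`∫ exp(‖y‖^α) d((1/λ_G)(μ_G - f_G)/σ_G) ≤ e · sup_x E_{α,γ}(λ_x)`. -/
theorem shifted_scaled_average_kernel_exp_moment_bound
    {d T : ℕ} {r α γ L Lf : ℝ} {μ : Measure (PathT d T)}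
    (κ : KernelData d T μ) (hS : Setting3 d T r α γ L Lf μ κ) :
    ∀ (t : ℕ) (ht : t < T), 1 ≤ t → ∀ N : ℕ, 1 ≤ N →
    ∀ G ∈ unifCells d t (mOf d T N) ∪ nonUnifCells d t (mOf d T N),
    ∃ fG : E d,
      0 < max (sSup ((fun a => κ.sig t ht a) '' G)) 1 ∧
      0 < 2 * (Lf * (cellDiam G).toReal + 1) + 2 * γ ^ (-α) ∧
      ∫⁻ y, ENNReal.ofReal (Real.exp (‖y‖ ^ α))
          ∂((avgKer μ ht G).map (fun y =>
            ((max (sSup ((fun a => κ.sig t ht a) '' G)) 1 *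
              (2 * (Lf * (cellDiam G).toReal + 1) + 2 * γ ^ (-α)))⁻¹) • (y - fG)))
        ≤ ENNReal.ofReal (Real.exp 1) * ⨆ a : PathT d t, ExpM α γ (κ.lam t ht a) := by
  intro t ht h1t N hN G hG
  have := hS.hprob
  have := κ.lamProb t ht
  have hα1 : 1 ≤ α := one_le_two.trans hS.hα
  have hα0 : 0 < α := by linarith
  have hγ := hS.hγ
  have hLf := hS.hLf
  obtain ⟨R, hR⟩ := exists_sumNorm_le_of_mem_cells (mOf_pos d T hN) hG
  have hdiam := cellDiam_ne_top hR
  have hLD : 0 ≤ Lf * (cellDiam G).toReal := by positivity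
  have hp : 0 < γ ^ (-α) := Real.rpow_pos_of_pos hγ _
  set S := max (sSup ((fun a => κ.sig t ht a) '' G)) 1
  have hS1 : 1 ≤ S := le_max_right _ _
  have hmeas : ∀ w : E d, Measurable fun y : E d =>
      (S * (2 * (Lf * (cellDiam G).toReal + 1) + 2 * γ ^ (-α)))⁻¹ • (y - w) := fun w => by
    fun_prop
  have hexp : Measurable fun y : E d => ENNReal.ofReal (Real.exp (‖y‖ ^ α)) := by fun_prop
  suffices h : ∃ fG : E d, ∫⁻ y, ENNReal.ofReal (Real.exp
      (‖(S * (2 * (Lf * (cellDiam G).toReal + 1) + 2 * γ ^ (-α)))⁻¹ • (y - fG)‖ ^ α))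
        ∂avgKer μ ht G ≤ ENNReal.ofReal (Real.exp 1) * ⨆ a, ExpM α γ (κ.lam t ht a) by
    obtain ⟨fG, h⟩ := h
    refine ⟨fG, by linarith, by positivity, ?_⟩
    rwa [lintegral_map hexp (hmeas fG)]
  by_cases hμ : μ (restr d T ht.le ⁻¹' G) = 0
  · refine ⟨0, ?_⟩
    rw [avgKer, if_pos hμ, lintegral_dirac]
    simp only [sub_zero, smul_zero, norm_zero, Real.zero_rpow hα0.ne', Real.exp_zero,
      ENNReal.ofReal_one]
    exact one_le_mul (ENNReal.one_le_ofReal.mpr (Real.one_le_exp zero_le_one))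
      ((one_le_ExpM hγ.le (κ.lam t ht 0)).trans (le_iSup (fun a => ExpM α γ (κ.lam t ht a)) 0))
  · obtain ⟨x, hx⟩ := nonempty_of_measure_ne_zero hμ
    refine ⟨κ.f t ht (restr d T ht.le x), (κ.disint t ht h1t).lintegral_avgKer_le
      (measurableSet_of_mem_cells hG) hμ (hexp.comp (hmeas _)) fun a ha => ?_⟩
    obtain ⟨c, hc, hgrow⟩ := hS.hgrow
    have hbdd : BddAbove ((fun a => κ.sig t ht a) '' G) := by
      refine ⟨c * R ^ r, ?_⟩
      rintro _ ⟨b, hb, rfl⟩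
      exact (hgrow t ht b h1t).trans (mul_le_mul_of_nonneg_left (Real.rpow_le_rpow
        (Finset.sum_nonneg fun s _ => norm_nonneg _) (hR b hb) hS.hr) hc.le)
    have hsig : κ.sig t ht a ≤ S := (le_csSup hbdd ⟨a, ha, rfl⟩).trans (le_max_left _ _)
    have hf : ‖κ.f t ht a - κ.f t ht (restr d T ht.le x)‖ ≤ Lf * (cellDiam G).toReal :=
      (hS.hfLip t ht h1t a _).trans
        (mul_le_mul_of_nonneg_left (sumDist_le_toReal_cellDiam hdiam ha hx) hLf.le)
    rw [κ.decomp t ht a h1t, lintegral_map (hexp.comp (hmeas _)) (by fun_prop)]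
    exact (lintegral_exp_affine_le hα1 hγ hLD (κ.sigNonneg t ht a) hsig hS1 hf _).trans
      (mul_le_mul_right (le_iSup (fun a => ExpM α γ (κ.lam t ht a)) a) _)
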